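/- arXiv:2003.12446 — 2 statements merged into one kernel-verified Lean document; each statement's English description precedes it below -/
import Mathlib

section
/- Let n ≥ 1 be an integer, let ψ satisfy the stated assumptions, let p > 1 and let R > 0. Set C := (2(3p+1)/(p−1)²)^{1/(p−1)} and define w : [0,R) → ℝ by w(r) := C · H(R)^{1/(p−1)} · (H(R) − H(r))^{−2/(p−1)}. Then w is twice differentiable on (0,R) and for every r ∈ (0,R) it satisfies the radial supersolution inequality w''(r) + (n−1)·(ψ'(r)/ψ(r))·w'(r) ≤ w(r)^p. -/
open MeasureTheory intervalIntegral

/-- The fundamental theorem of calculus at a positive endpoint. -/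
theorem hasDerivAt_integral_of_continuousOn_Ici {f : ℝ → ℝ} (hf : ContinuousOn f (Set.Ici 0))
    {r : ℝ} (hr : 0 < r) : HasDerivAt (fun x => ∫ t in (0:ℝ)..x, f t) (f r) r := by
  have hint : IntervalIntegrable f volume 0 r :=
    (hf.mono (by rw [Set.uIcc_of_le hr.le]; exact Set.Icc_subset_Ici_self)).intervalIntegrable
  have hopen : ContinuousOn f (Set.Ioi 0) := hf.mono Set.Ioi_subset_Ici_self
  exact integral_hasDerivAt_right hint
    (hopen.stronglyMeasurableAtFilter isOpen_Ioi r hr) (hopen.continuousAt (Ioi_mem_nhds hr))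

/-- The derivative of the quotient `I / ψ ^ m` of a primitive `I` of `ψ ^ m` by `ψ ^ m`. -/
theorem hasDerivAt_primitive_div_pow {I ψ : ℝ → ℝ} {m : ℕ} {r ψ' : ℝ}
    (hI : HasDerivAt I (ψ r ^ m) r) (hψ : HasDerivAt ψ ψ' r) (hr : 0 < ψ r) :
    HasDerivAt (fun x => I x / ψ x ^ m) (1 - m * (ψ' / ψ r) * (I r / ψ r ^ m)) r := by
  refine (hI.fun_div (hψ.fun_pow m) (pow_pos hr m).ne').congr_deriv ?_
  symm
  rcases m with _ | k
  · simp
  · have := hr.ne'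
    simp only [Nat.add_sub_cancel]
    field_simp
    ring

/-- If `g ≥ 0` and `g' ≤ 1`, then `g ^ 2 / 2` is bounded by a primitive `G` of `g`, provided
both vanish at the origin. -/
theorem sq_le_two_mul_primitive {g G g' : ℝ → ℝ} (hg : ContinuousOn g (Set.Ici 0))
    (hG : ContinuousOn G (Set.Ici 0)) (hg0 : g 0 = 0) (hG0 : G 0 = 0)
    (hnonneg : ∀ r, 0 < r → 0 ≤ g r) (hdg : ∀ r, 0 < r → HasDerivAt g (g' r) r)
    (hdG : ∀ r, 0 < r → HasDerivAt G (g r) r) (hle : ∀ r, 0 < r → g' r ≤ 1)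
    {r : ℝ} (hr : 0 ≤ r) : g r ^ 2 ≤ 2 * G r := by
  have hd : ∀ x, 0 < x → HasDerivAt (fun x => g x ^ 2 - 2 * G x) (2 * g x * (g' x - 1)) x := by
    intro x hx
    refine (((hdg x hx).fun_pow 2).fun_sub ((hdG x hx).const_mul 2)).congr_deriv ?_
    norm_num
    ring
  have hanti : AntitoneOn (fun x => g x ^ 2 - 2 * G x) (Set.Ici 0) := by
    refine antitoneOn_of_deriv_nonpos (convex_Ici 0)
      ((hg.pow 2).sub (continuousOn_const.mul hG)) ?_ ?_
    · rw [interior_Ici]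
      exact fun x hx => (hd x hx).differentiableAt.differentiableWithinAt
    · rw [interior_Ici]
      intro x hx
      rw [(hd x hx).deriv]
      exact mul_nonpos_of_nonneg_of_nonpos (by linarith [hnonneg x hx]) (by linarith [hle x hx])
  have h := hanti Set.self_mem_Ici (Set.mem_Ici.2 hr) hr
  simp only [hg0, hG0] at h
  linarith

/-- The algebraic comparison of the two sides of the supersolution inequality. -/
theorem supersolution_algebra {p C A D h : ℝ} (hp : 1 < p) (hA : 0 < A) (hD : 0 < D)
    (hDA : D ≤ A) (hh : h ^ 2 ≤ 2 * A)
    (hC : C = (2 * (3 * p + 1) / (p - 1) ^ 2) ^ (1 / (p - 1))) :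
    C * A ^ (1 / (p - 1)) * (2 / (p - 1)) * D ^ (-2 / (p - 1) - 2) *
        ((2 / (p - 1) + 1) * h ^ 2 + D) ≤
      (C * A ^ (1 / (p - 1)) * D ^ (-2 / (p - 1))) ^ p := by
  have hp1 : 0 < p - 1 := by linarith
  set B : ℝ := 2 * (3 * p + 1) / (p - 1) ^ 2 with hB
  have hBpos : 0 < B := by positivity
  have hK : C * A ^ (1 / (p - 1)) = (B * A) ^ (1 / (p - 1)) := by
    rw [hC, Real.mul_rpow hBpos.le hA.le]
  rw [hK]
  set K : ℝ := (B * A) ^ (1 / (p - 1)) with hKdef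
  have hBA : 0 < B * A := by positivity
  have hKpos : 0 < K := Real.rpow_pos_of_pos hBA _
  have hKp : K ^ p = K * (B * A) := by
    have h1 : K ^ (p - 1) = B * A := by
      rw [hKdef, ← Real.rpow_mul hBA.le, one_div_mul_cancel hp1.ne', Real.rpow_one]
    rw [← h1, ← Real.rpow_one_add' hKpos.le (by linarith)]
    ring_nf
  have hDp : (D ^ (-2 / (p - 1))) ^ p = D ^ (-2 / (p - 1) - 2) := by
    rw [← Real.rpow_mul hD.le]
    congr 1
    field_simp
    ring
  rw [Real.mul_rpow hKpos.le (Real.rpow_nonneg hD.le _), hKp, hDp]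
  have hE : 0 < D ^ (-2 / (p - 1) - 2) := Real.rpow_pos_of_pos hD _
  have key : 2 / (p - 1) * ((2 / (p - 1) + 1) * h ^ 2 + D) ≤ B * A := by
    have h1 : (2 / (p - 1) + 1) * h ^ 2 + D ≤ (2 / (p - 1) + 1) * (2 * A) + A := by gcongr
    calc _ ≤ 2 / (p - 1) * ((2 / (p - 1) + 1) * (2 * A) + A) := by gcongr
      _ = B * A := by
        rw [hB]
        field_simp
        ring
  calc _ = K * D ^ (-2 / (p - 1) - 2) *
        (2 / (p - 1) * ((2 / (p - 1) + 1) * h ^ 2 + D)) := by ring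
    _ ≤ K * D ^ (-2 / (p - 1) - 2) * (B * A) := by gcongr
    _ = _ := by ring

theorem stmt_3 (n : ℕ) (hn : 1 ≤ n) (ψ : ℝ → ℝ)
    (hψC1 : ContDiffOn ℝ 1 ψ (Set.Ici 0))
    (hψsmooth : ContDiffOn ℝ (⊤ : ℕ∞) ψ (Set.Ioi 0))
    (hψ0 : ψ 0 = 0)
    (hψ'0 : derivWithin ψ (Set.Ici 0) 0 = 1)
    (hψ'nonneg : ∀ r : ℝ, 0 ≤ r → 0 ≤ derivWithin ψ (Set.Ici 0) r)
    (hψpos : ∀ r : ℝ, 0 < r → 0 < ψ r)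
    (H' H : ℝ → ℝ)
    (hH' : ∀ ρ : ℝ, H' ρ = (∫ ζ in (0:ℝ)..ρ, ψ ζ ^ (n - 1)) / ψ ρ ^ (n - 1))
    (hH : ∀ r : ℝ, H r = ∫ ρ in (0:ℝ)..r, H' ρ)
    (p R C : ℝ) (hp : 1 < p) (hR : 0 < R)
    (hC : C = (2 * (3 * p + 1) / (p - 1) ^ 2) ^ (1 / (p - 1)))
    (w : ℝ → ℝ)
    (hw : ∀ r : ℝ, w r = C * H R ^ (1 / (p - 1)) * (H R - H r) ^ (-2 / (p - 1))) :
    ∀ r ∈ Set.Ioo (0:ℝ) R,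
      DifferentiableAt ℝ w r ∧ DifferentiableAt ℝ (deriv w) r ∧
        deriv (deriv w) r + ((n : ℝ) - 1) * (deriv ψ r / ψ r) * deriv w r ≤ w r ^ p := by
  obtain ⟨m, rfl⟩ : ∃ m, n = m + 1 := ⟨n - 1, by omega⟩
  simp only [Nat.add_sub_cancel] at hH'
  have hp1 : 0 < p - 1 := by linarith
  have hψc : ContinuousOn ψ (Set.Ici 0) := hψC1.continuousOn
  have hψd : ∀ r, 0 < r → HasDerivAt ψ (deriv ψ r) r := fun r hr =>
    ((hψsmooth.differentiableOn (by simp)).differentiableAt (Ioi_mem_nhds hr)).hasDerivAt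
  have hψd0 : ∀ r, 0 < r → 0 ≤ deriv ψ r := fun r hr => by
    rw [← derivWithin_of_mem_nhds (Ici_mem_nhds hr)]
    exact hψ'nonneg r hr.le
  have hmono : MonotoneOn ψ (Set.Ici 0) := by
    refine monotoneOn_of_deriv_nonneg (convex_Ici 0) hψc ?_ ?_
    · rw [interior_Ici]
      exact fun x hx => (hψd x hx).differentiableAt.differentiableWithinAt
    · rw [interior_Ici]
      exact hψd0
  have hψnn : ∀ r, 0 ≤ r → 0 ≤ ψ r := fun r hr => by
    simpa [hψ0] using hmono Set.self_mem_Ici (Set.mem_Ici.2 hr) hr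
  have hpowc : ContinuousOn (fun x => ψ x ^ m) (Set.Ici 0) := hψc.pow m
  have hpowi : ∀ r, 0 ≤ r → IntervalIntegrable (fun x => ψ x ^ m) volume 0 r := fun r hr =>
    (hpowc.mono (by rw [Set.uIcc_of_le hr]; exact Set.Icc_subset_Ici_self)).intervalIntegrable
  have hH'd : ∀ r, 0 < r → HasDerivAt H' (1 - m * (deriv ψ r / ψ r) * H' r) r := by
    intro r hr
    rw [hH' r, funext hH']
    exact hasDerivAt_primitive_div_pow (hasDerivAt_integral_of_continuousOn_Ici hpowc hr)
      (hψd r hr) (hψpos r hr)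
  have hH'0 : H' 0 = 0 := by simp [hH']
  have hH'pos : ∀ r, 0 < r → 0 < H' r := fun r hr => by
    rw [hH']
    exact div_pos (intervalIntegral_pos_of_pos_on (hpowi r hr.le)
      (fun x hx => pow_pos (hψpos x hx.1) m) hr) (pow_pos (hψpos r hr) m)
  have hH'le : ∀ r, 0 < r → H' r ≤ r := fun r hr => by
    rw [hH', div_le_iff₀ (pow_pos (hψpos r hr) m)]
    have := integral_mono_on hr.le (hpowi r hr.le) intervalIntegrable_const
      (fun x hx => pow_le_pow_left₀ (hψnn x hx.1)
        (hmono (Set.mem_Ici.2 hx.1) (Set.mem_Ici.2 hr.le) hx.2) m)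
    simpa using this
  have hH'c : ContinuousOn H' (Set.Ici 0) := by
    intro r hr
    rcases (Set.mem_Ici.1 hr).eq_or_lt with rfl | hr
    · have hid : Filter.Tendsto (fun x : ℝ => x) (nhdsWithin 0 (Set.Ici 0)) (nhds 0) :=
        Filter.tendsto_id.mono_left nhdsWithin_le_nhds
      rw [ContinuousWithinAt, hH'0]
      refine tendsto_of_tendsto_of_tendsto_of_le_of_le' tendsto_const_nhds hid ?_ ?_
      all_goals
        filter_upwards [self_mem_nhdsWithin] with x hx
        rcases (Set.mem_Ici.1 hx).eq_or_lt with rfl | hx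
        · simp [hH'0]
        · linarith [hH'pos x hx, hH'le x hx]
    · exact (hH'd r hr).continuousAt.continuousWithinAt
  have hHd : ∀ r, 0 < r → HasDerivAt H (H' r) r := fun r hr => by
    rw [funext hH]
    exact hasDerivAt_integral_of_continuousOn_Ici hH'c hr
  have hH0 : H 0 = 0 := by simp [hH]
  have hHc : ContinuousOn H (Set.Ici 0) := by
    rw [funext hH]
    intro r hr
    have hr0 : (0:ℝ) ≤ r := hr
    have hint : IntegrableOn H' (Set.uIcc 0 (r + 1)) volume := by
      rw [Set.uIcc_of_le (by linarith)]
      exact (hH'c.mono Set.Icc_subset_Ici_self).integrableOn_Icc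
    have h := continuousOn_primitive_interval hint
    rw [Set.uIcc_of_le (by linarith)] at h
    refine (h r ⟨hr0, by linarith⟩).mono_of_mem_nhdsWithin ?_
    rw [← Set.Ici_inter_Iic]
    exact Filter.inter_mem self_mem_nhdsWithin
      (mem_nhdsWithin_of_mem_nhds (Iic_mem_nhds (by linarith)))
  have hHmono : StrictMonoOn H (Set.Ici 0) := by
    refine strictMonoOn_of_deriv_pos (convex_Ici 0) hHc ?_
    rw [interior_Ici]
    intro x hx
    rw [(hHd x hx).deriv]
    exact hH'pos x hx
  have hsq : ∀ r, 0 ≤ r → H' r ^ 2 ≤ 2 * H r := fun r hr =>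
    sq_le_two_mul_primitive hH'c hHc hH'0 hH0 (fun r hr => (hH'pos r hr).le) hH'd hHd
      (fun r hr => by
        have := hψd0 r hr
        have := hψpos r hr
        have := hH'pos r hr
        exact sub_le_self _ (by positivity)) hr
  have hgap : ∀ r ∈ Set.Ioo (0:ℝ) R, 0 < H R - H r := fun r hr =>
    sub_pos.2 (hHmono (Set.mem_Ici.2 hr.1.le) (Set.mem_Ici.2 hR.le) hr.2)
  set K : ℝ := C * H R ^ (1 / (p - 1)) with hK
  have hpowd : ∀ q : ℝ, ∀ r ∈ Set.Ioo (0:ℝ) R,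
      HasDerivAt (fun x => (H R - H x) ^ q) (-H' r * q * (H R - H r) ^ (q - 1)) r :=
    fun q r hr => ((hHd r hr.1).const_sub (H R)).rpow_const (Or.inl (hgap r hr).ne')
  set a : ℝ := -2 / (p - 1) with ha
  have hwd : ∀ r ∈ Set.Ioo (0:ℝ) R,
      HasDerivAt w (K * (-H' r * a * (H R - H r) ^ (a - 1))) r := fun r hr => by
    rw [funext hw]
    exact (hpowd a r hr).const_mul K
  intro r hr
  have hdw : deriv w =ᶠ[nhds r] fun x => K * (-H' x * a * (H R - H x) ^ (a - 1)) := by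
    filter_upwards [Ioo_mem_nhds hr.1 hr.2] with x hx
    exact (hwd x hx).deriv
  have hwdd := (((((hH'd r hr.1).fun_neg.mul_const a).fun_mul
    (hpowd (a - 1) r hr)).const_mul K).congr_of_eventuallyEq hdw)
  refine ⟨(hwd r hr).differentiableAt, hwdd.differentiableAt, ?_⟩
  rw [hwdd.deriv, (hwd r hr).deriv, hw r]
  have hD := hgap r hr
  have hHr : 0 < H r := by
    simpa [hH0] using hHmono Set.self_mem_Ici (Set.mem_Ici.2 hr.1.le) hr.1
  have halg := supersolution_algebra (h := H' r) hp (by linarith : 0 < H R) hD (by linarith)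
    (by linarith [hsq r hr.1.le]) hC
  rw [← hK, ← ha] at halg
  refine le_of_eq_of_le ?_ halg
  have ha' : 2 / (p - 1) = -a := by rw [ha]; ring
  have hE : (H R - H r) ^ (a - 1) = (H R - H r) ^ (a - 2) * (H R - H r) := by
    rw [← Real.rpow_add_one hD.ne']
    ring_nf
  rw [ha', show a - 1 - 1 = a - 2 by ring, hE]
  push_cast
  ring
end

section
/- Let n ≥ 1 and m ∈ (0,1). Let u, v be classical solutions of the fast diffusion equation on ℝⁿ × (0,∞) (no ordering assumed). Let ψ : ℝⁿ → ℝ be a C² nonnegative function whose support is contained in a compact set K, and let B ≥ 0 satisfy |Δψ(x)| ≤ B·ψ(x)^m for every x ∈ ℝⁿ. Then for all 0 < s ≤ t, setting z(τ) := ∫_{ℝⁿ} |u(x,τ) − v(x,τ)|·ψ(x) dx, one has z(t)^{1−m} ≤ z(s)^{1−m} + (1−m)·2^{1−m}·B·λ(K)^{1−m}·(t−s), where λ denotes Lebesgue measure. -/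
open MeasureTheory

/-- The Euclidean Laplacian: trace of the second derivative, computed as the sum of the
second directional derivatives along the standard orthonormal basis. -/
noncomputable def laplacian {n : ℕ} (f : EuclideanSpace ℝ (Fin n) → ℝ)
    (x : EuclideanSpace ℝ (Fin n)) : ℝ :=
  ∑ i : Fin n,
    fderiv ℝ (fun y => fderiv ℝ f y (EuclideanSpace.single i 1)) x (EuclideanSpace.single i 1)

open Filter Topology

theorem tendsto_sqrt_sq_add (r : ℝ) :
    Tendsto (fun k : ℕ => √(r ^ 2 + 1 / ((k : ℝ) + 1))) atTop (𝓝 |r|) := by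
  have h := (tendsto_one_div_add_atTop_nhds_zero_nat (𝕜 := ℝ)).const_add (r ^ 2)
  simpa [Real.sqrt_sq_eq_abs] using h.sqrt

theorem tendsto_div_sqrt_sq_add (r : ℝ) :
    Tendsto (fun k : ℕ => r / √(r ^ 2 + 1 / ((k : ℝ) + 1))) atTop (𝓝 (Real.sign r)) := by
  rcases eq_or_ne r 0 with rfl | hr
  · simp
  have h2 : r / |r| = Real.sign r := by
    rcases lt_or_gt_of_ne hr with h | h
    · rw [Real.sign_of_neg h, abs_of_neg h, div_neg, div_self hr]
    · rw [Real.sign_of_pos h, abs_of_pos h, div_self hr]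
  rw [← h2]
  exact tendsto_const_nhds.div (tendsto_sqrt_sq_add r) (abs_ne_zero.mpr hr)

theorem abs_div_sqrt_sq_add_le_one (r : ℝ) {ε : ℝ} (hε : 0 ≤ ε) : |r / √(r ^ 2 + ε)| ≤ 1 := by
  rw [abs_div, abs_of_nonneg (Real.sqrt_nonneg _)]
  exact div_le_one_of_le₀ (Real.abs_le_sqrt (by linarith)) (Real.sqrt_nonneg _)

theorem measurable_real_sign : Measurable Real.sign := by
  unfold Real.sign
  exact Measurable.ite measurableSet_Iio measurable_const
    (Measurable.ite measurableSet_Ioi measurable_const measurable_const)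

theorem abs_real_sign_le_one (r : ℝ) : |Real.sign r| ≤ 1 := by
  rcases Real.sign_apply_eq r with h | h | h <;> simp [h]

theorem hasDerivAt_sqrt_sq_add (r : ℝ) {ε : ℝ} (hε : 0 < ε) :
    HasDerivAt (fun r : ℝ => √(r ^ 2 + ε)) (r / √(r ^ 2 + ε)) r := by
  have h0 : r ^ 2 + ε ≠ 0 := by positivity
  have h := ((hasDerivAt_pow 2 r).add_const ε).sqrt h0
  refine h.congr_deriv ?_
  simp only [Nat.cast_ofNat, Nat.add_one_sub_one, pow_one]
  field_simp

theorem hasDerivAt_div_sqrt_sq_add (r : ℝ) {ε : ℝ} (hε : 0 < ε) :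
    HasDerivAt (fun r : ℝ => r / √(r ^ 2 + ε)) (ε / √(r ^ 2 + ε) ^ 3) r := by
  have h0 : 0 < r ^ 2 + ε := by positivity
  have h1 := Real.sqrt_pos.mpr h0
  have h2 := Real.sq_sqrt h0.le
  refine ((hasDerivAt_id' r).fun_div (hasDerivAt_sqrt_sq_add r hε) h1.ne').congr_deriv ?_
  field_simp
  linarith

theorem integral_sign_mul_deriv {w w' : ℝ → ℝ} {a b : ℝ} (hab : a ≤ b)
    (hw : ∀ τ ∈ Set.Icc a b, HasDerivAt w (w' τ) τ) (hw' : ContinuousOn w' (Set.Icc a b)) :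
    ∫ τ in a..b, Real.sign (w τ) * w' τ = |w b| - |w a| := by
  have hwc : ContinuousOn w (Set.Icc a b) := fun τ hτ => (hw τ hτ).continuousAt.continuousWithinAt
  have hint (k : ℕ) : ∫ τ in a..b, w τ / √(w τ ^ 2 + 1 / ((k : ℝ) + 1)) * w' τ =
      √(w b ^ 2 + 1 / ((k : ℝ) + 1)) - √(w a ^ 2 + 1 / ((k : ℝ) + 1)) := by
    have hk : 0 < 1 / ((k : ℝ) + 1) := by positivity
    refine intervalIntegral.integral_eq_sub_of_hasDerivAt
      (f := fun τ => √(w τ ^ 2 + 1 / ((k : ℝ) + 1))) (fun τ hτ => ?_) ?_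
    · rw [Set.uIcc_of_le hab] at hτ
      exact (hasDerivAt_sqrt_sq_add (w τ) hk).comp τ (hw τ hτ)
    · apply ContinuousOn.intervalIntegrable
      rw [Set.uIcc_of_le hab]
      refine ContinuousOn.mul (hwc.div (by fun_prop) fun τ _ => ?_) hw'
      positivity
  refine tendsto_nhds_unique ?_ ((tendsto_sqrt_sq_add (w b)).sub (tendsto_sqrt_sq_add (w a)))
  simp_rw [← hint]
  have hsub : Set.uIoc a b ⊆ Set.Icc a b := by
    rw [Set.uIoc_of_le hab]; exact Set.Ioc_subset_Icc_self
  refine intervalIntegral.tendsto_integral_filter_of_dominated_convergence (fun τ => |w' τ|)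
    (.of_forall fun k => ?_) (.of_forall fun k => .of_forall fun τ _ => ?_) ?_
    (.of_forall fun τ _ => (tendsto_div_sqrt_sq_add (w τ)).mul_const _)
  · refine ContinuousOn.aestronglyMeasurable ?_ measurableSet_uIoc
    refine ContinuousOn.mono (ContinuousOn.mul (hwc.div (by fun_prop) fun τ _ => ?_) hw') hsub
    positivity
  · rw [Real.norm_eq_abs, abs_mul]
    exact mul_le_of_le_one_left (abs_nonneg _) (abs_div_sqrt_sq_add_le_one _ (by positivity))
  · apply ContinuousOn.intervalIntegrable
    rw [Set.uIcc_of_le hab]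
    exact hw'.abs

theorem rpow_le_rpow_add_of_le_integral_rpow {m C s t : ℝ} (hm : m ∈ Set.Ioo (0 : ℝ) 1)
    (hC : 0 ≤ C) (hst : s ≤ t) {z : ℝ → ℝ} (hz : Continuous z) (hz0 : ∀ τ, 0 ≤ z τ)
    (h : ∀ b, s ≤ b → z b ≤ z s + C * ∫ τ in s..b, z τ ^ m) :
    z t ^ (1 - m) ≤ z s ^ (1 - m) + (1 - m) * C * (t - s) := by
  have hzm : Continuous fun τ => z τ ^ m := hz.rpow_const fun _ => Or.inr hm.1.le
  have key : ∀ δ ∈ Set.Ioi (0 : ℝ),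
      z t ^ (1 - m) ≤ (z s + δ) ^ (1 - m) + (1 - m) * C * (t - s) := by
    intro δ (hδ : 0 < δ)
    set Y : ℝ → ℝ := fun b => z s + δ + C * ∫ τ in s..b, z τ ^ m with hY
    have hYd (b : ℝ) : HasDerivAt Y (C * z b ^ m) b :=
      ((hzm.integral_hasStrictDerivAt s b).hasDerivAt.const_mul C).const_add _
    have hYpos : ∀ b ∈ Set.Icc s t, 0 < Y b ∧ z b ≤ Y b := fun b hb => by
      have := h b hb.1
      have := hz0 b
      constructor <;> simp only [hY] <;> linarith
    have hd : ∀ b ∈ Set.Icc s t, HasDerivAt (fun b => Y b ^ (1 - m))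
        (C * z b ^ m * (1 - m) * Y b ^ (1 - m - 1)) b := fun b hb =>
      (hYd b).rpow_const (Or.inl (hYpos b hb).1.ne')
    have := Convex.image_sub_le_mul_sub_of_deriv_le (convex_Icc s t)
      (f := fun b => Y b ^ (1 - m)) (C := (1 - m) * C)
      (fun b hb => (hd b hb).continuousAt.continuousWithinAt)
      (fun b hb => (hd b (interior_subset hb)).differentiableAt.differentiableWithinAt)
      (fun b hb => ?_) s (Set.left_mem_Icc.2 hst) t (Set.right_mem_Icc.2 hst) hst
    · have hYs : Y s = z s + δ := by simp [hY]
      have hle : z t ^ (1 - m) ≤ Y t ^ (1 - m) :=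
        Real.rpow_le_rpow (hz0 t) (hYpos t (Set.right_mem_Icc.2 hst)).2 (by linarith [hm.2])
      simp only [hYs] at this
      linarith
    · have hb' := interior_subset hb
      obtain ⟨h1, h2⟩ := hYpos b hb'
      rw [(hd b hb').deriv]
      have e : Y b ^ m * Y b ^ (1 - m - 1) = 1 := by
        rw [← Real.rpow_add h1]; simp
      have h3 : z b ^ m * Y b ^ (1 - m - 1) ≤ 1 :=
        (mul_le_mul_of_nonneg_right (Real.rpow_le_rpow (hz0 b) h2 hm.1.le)
          (by positivity)).trans e.le
      have h4 : 0 ≤ (1 - m) * C := mul_nonneg (by linarith [hm.2]) hC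
      nlinarith [mul_le_mul_of_nonneg_left h3 h4]
  refine ge_of_tendsto (x := 𝓝[>] (0 : ℝ)) (f := fun δ => (z s + δ) ^ (1 - m) + (1 - m) * C * (t - s))
    ?_ (Filter.eventually_of_mem self_mem_nhdsWithin key)
  have hc : Continuous fun δ : ℝ => (z s + δ) ^ (1 - m) + (1 - m) * C * (t - s) :=
    ((continuous_const.add continuous_id).rpow_const
      fun _ => Or.inr (by linarith [hm.2])).add continuous_const
  simpa using (hc.tendsto 0).mono_left nhdsWithin_le_nhds

theorem abs_rpow_sub_rpow_le {m a b : ℝ} (hm0 : 0 ≤ m) (hm1 : m ≤ 1) (ha : 0 ≤ a) (hb : 0 ≤ b) :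
    |a ^ m - b ^ m| ≤ |a - b| ^ m := by
  wlog hab : b ≤ a generalizing a b
  · rw [abs_sub_comm, abs_sub_comm a]
    exact this hb ha (le_of_not_ge hab)
  rw [abs_of_nonneg (sub_nonneg.2 (Real.rpow_le_rpow hb hab hm0)),
    abs_of_nonneg (sub_nonneg.2 hab), sub_le_iff_le_add]
  simpa using Real.rpow_add_le_add_rpow (sub_nonneg.2 hab) hb hm0 hm1

theorem sign_rpow_sub_rpow {m a b : ℝ} (hm0 : 0 < m) (ha : 0 ≤ a) (hb : 0 ≤ b) :
    Real.sign (a ^ m - b ^ m) = Real.sign (a - b) := by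
  rcases lt_trichotomy a b with h | rfl | h
  · rw [Real.sign_of_neg (sub_neg.2 h),
      Real.sign_of_neg (sub_neg.2 (Real.rpow_lt_rpow ha h hm0))]
  · simp
  · rw [Real.sign_of_pos (sub_pos.2 h),
      Real.sign_of_pos (sub_pos.2 (Real.rpow_lt_rpow hb h hm0))]

theorem setIntegral_rpow_le {α : Type*} [MeasurableSpace α] {μ : Measure α} {K : Set α}
    (hK : μ K ≠ ⊤) {m : ℝ} (hm : m ∈ Set.Ioo (0 : ℝ) 1) {f : α → ℝ} (hf0 : ∀ x, 0 ≤ f x)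
    (hf : IntegrableOn f K μ) :
    ∫ x in K, f x ^ m ∂μ ≤ (μ K).toReal ^ (1 - m) * (∫ x in K, f x ∂μ) ^ m := by
  have hpq : (1 / m).HolderConjugate (1 / (1 - m)) := by
    have := hm.1
    have : 0 < 1 - m := by linarith [hm.2]
    rw [Real.holderConjugate_iff]
    constructor
    · rw [lt_div_iff₀ hm.1]; linarith [hm.2]
    · simp
  have : IsFiniteMeasure (μ.restrict K) := ⟨by simpa using hK.lt_top⟩
  have hm0 := hm.1
  have hmem : MemLp (fun x => f x ^ m) (ENNReal.ofReal (1 / m)) (μ.restrict K) := by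
    have := (memLp_one_iff_integrable.2 hf).norm_rpow_div (ENNReal.ofReal m)
    simp only [ENNReal.toReal_ofReal hm0.le, Real.norm_of_nonneg (hf0 _)] at this
    rwa [ENNReal.ofReal_div_of_pos hm0, ENNReal.ofReal_one]
  have := integral_mul_le_Lp_mul_Lq_of_nonneg hpq (μ := μ.restrict K) (f := fun x => f x ^ m)
    (g := fun _ => 1) (.of_forall fun x => Real.rpow_nonneg (hf0 x) m)
    (.of_forall fun x => zero_le_one) hmem (memLp_const 1)
  have e (x : α) : (f x ^ m) ^ (1 / m) = f x := by
    rw [← Real.rpow_mul (hf0 x), mul_one_div_cancel hm0.ne', Real.rpow_one]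
  simp only [e, mul_one, Real.one_rpow, one_div_one_div, integral_const, smul_eq_mul,
    measureReal_restrict_apply_univ] at this
  rw [mul_comm]
  simpa [Measure.real] using this

theorem ContDiff.fderiv_two_apply {E : Type*} [NormedAddCommGroup E] [NormedSpace ℝ E]
    {f : E → ℝ} (hf : ContDiff ℝ 2 f) (e : E) : ContDiff ℝ 1 fun y => fderiv ℝ f y e :=
  (hf.fderiv_right (m := 1) (by norm_num)).clm_apply contDiff_const

theorem ContDiff.continuous_fderiv_fderiv_apply {E : Type*} [NormedAddCommGroup E]
    [NormedSpace ℝ E] {f : E → ℝ} (hf : ContDiff ℝ 2 f) (e : E) :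
    Continuous fun x => fderiv ℝ (fun y => fderiv ℝ f y e) x e :=
  ((hf.fderiv_two_apply e).continuous_fderiv one_ne_zero).clm_apply continuous_const

theorem ContDiff.continuous_laplacian {n : ℕ} {f : EuclideanSpace ℝ (Fin n) → ℝ}
    (hf : ContDiff ℝ 2 f) : Continuous (laplacian f) :=
  continuous_finsetSum _ fun _ _ => hf.continuous_fderiv_fderiv_apply _

theorem HasCompactSupport.laplacian {n : ℕ} {f : EuclideanSpace ℝ (Fin n) → ℝ}
    (hf : HasCompactSupport f) : HasCompactSupport (laplacian f) := by
  refine hf.of_isClosed_subset (isClosed_tsupport _)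
    (closure_minimal (fun x hx => ?_) (isClosed_tsupport _))
  by_contra hx'
  refine hx (Finset.sum_eq_zero fun i _ => ?_)
  by_contra h
  exact hx' (tsupport_fderiv_apply_subset ℝ (EuclideanSpace.single i 1)
    (tsupport_fderiv_apply_subset ℝ (EuclideanSpace.single i 1) (subset_tsupport _ h)))

theorem laplacian_sub {n : ℕ} {f g : EuclideanSpace ℝ (Fin n) → ℝ}
    (hf : ContDiff ℝ 2 f) (hg : ContDiff ℝ 2 g) (x : EuclideanSpace ℝ (Fin n)) :
    laplacian (fun y => f y - g y) x = laplacian f x - laplacian g x := by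
  unfold laplacian
  rw [← Finset.sum_sub_distrib]
  refine Finset.sum_congr rfl fun i _ => ?_
  have h : (fun y => fderiv ℝ (fun y => f y - g y) y (EuclideanSpace.single i 1)) = fun y =>
      fderiv ℝ f y (EuclideanSpace.single i 1) - fderiv ℝ g y (EuclideanSpace.single i 1) := by
    ext y
    rw [fderiv_fun_sub (hf.differentiable two_ne_zero y) (hg.differentiable two_ne_zero y)]
    rfl
  rw [h, fderiv_fun_sub ((hf.fderiv_two_apply _).differentiable one_ne_zero x)
    ((hg.fderiv_two_apply _).differentiable one_ne_zero x)]
  rfl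

theorem integral_mul_laplacian_eq {n : ℕ} {h ψ : EuclideanSpace ℝ (Fin n) → ℝ}
    (hh : ContDiff ℝ 2 h) (hψ : ContDiff ℝ 2 ψ) (hc : HasCompactSupport ψ) :
    ∫ x, h x * laplacian ψ x = ∫ x, laplacian h x * ψ x := by
  unfold laplacian
  simp_rw [Finset.mul_sum, Finset.sum_mul]
  have hci (i : Fin n) := hc.fderiv_apply ℝ (EuclideanSpace.single i (1 : ℝ))
  have hcii (i : Fin n) := (hci i).fderiv_apply ℝ (EuclideanSpace.single i (1 : ℝ))
  have hi (i : Fin n) := (hψ.fderiv_two_apply (EuclideanSpace.single i 1)).continuous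
  have hhi (i : Fin n) := (hh.fderiv_two_apply (EuclideanSpace.single i 1)).continuous
  have int1 (i : Fin n) : Integrable fun x => h x * fderiv ℝ
      (fun y => fderiv ℝ ψ y (EuclideanSpace.single i 1)) x (EuclideanSpace.single i 1) :=
    (hh.continuous.mul (hψ.continuous_fderiv_fderiv_apply _)).integrable_of_hasCompactSupport
      (hcii i).mul_left
  have int2 (i : Fin n) : Integrable fun x => fderiv ℝ
      (fun y => fderiv ℝ h y (EuclideanSpace.single i 1)) x (EuclideanSpace.single i 1) * ψ x :=
    ((hh.continuous_fderiv_fderiv_apply _).mul hψ.continuous).integrable_of_hasCompactSupport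
      hc.mul_left
  have int3 (i : Fin n) : Integrable fun x =>
      fderiv ℝ h x (EuclideanSpace.single i 1) * fderiv ℝ ψ x (EuclideanSpace.single i 1) :=
    ((hhi i).mul (hi i)).integrable_of_hasCompactSupport (hci i).mul_left
  have int4 (i : Fin n) : Integrable fun x =>
      h x * fderiv ℝ ψ x (EuclideanSpace.single i 1) :=
    (hh.continuous.mul (hi i)).integrable_of_hasCompactSupport (hci i).mul_left
  have int5 (i : Fin n) : Integrable fun x =>
      fderiv ℝ h x (EuclideanSpace.single i 1) * ψ x :=
    ((hhi i).mul hψ.continuous).integrable_of_hasCompactSupport hc.mul_left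
  rw [integral_finsetSum _ fun i _ => int1 i, integral_finsetSum _ fun i _ => int2 i]
  refine Finset.sum_congr rfl fun i _ => ?_
  rw [integral_mul_fderiv_eq_neg_fderiv_mul_of_integrable (int3 i) (int1 i) (int4 i)
      (fun x _ => hh.differentiable two_ne_zero x)
      (fun x _ => (hψ.fderiv_two_apply _).differentiable one_ne_zero x),
    integral_mul_fderiv_eq_neg_fderiv_mul_of_integrable (int2 i) (int3 i) (int5 i)
      (fun x _ => (hh.fderiv_two_apply _).differentiable one_ne_zero x)
      (fun x _ => hψ.differentiable two_ne_zero x), neg_neg]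

theorem mul_laplacian_le_laplacian_sqrt_sq_add {n : ℕ} {g : EuclideanSpace ℝ (Fin n) → ℝ}
    (hg : ContDiff ℝ 2 g) {ε : ℝ} (hε : 0 < ε) (x : EuclideanSpace ℝ (Fin n)) :
    g x / √(g x ^ 2 + ε) * laplacian g x ≤ laplacian (fun y => √(g y ^ 2 + ε)) x := by
  unfold laplacian
  rw [Finset.mul_sum]
  refine Finset.sum_le_sum fun i _ => ?_
  set e : EuclideanSpace ℝ (Fin n) := EuclideanSpace.single i 1
  have hd (y) : HasFDerivAt g (fderiv ℝ g y) y := (hg.differentiable two_ne_zero y).hasFDerivAt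
  have h1 : (fun y => fderiv ℝ (fun y => √(g y ^ 2 + ε)) y e) =
      fun y => g y / √(g y ^ 2 + ε) * fderiv ℝ g y e := by
    ext y
    have h : HasFDerivAt (fun y => √(g y ^ 2 + ε)) _ y :=
      (hasDerivAt_sqrt_sq_add (g y) hε).comp_hasFDerivAt y (hd y)
    rw [h.fderiv]
    rfl
  have h2 : HasFDerivAt (fun y => g y / √(g y ^ 2 + ε) * fderiv ℝ g y e) _ x := ((hasDerivAt_div_sqrt_sq_add (g x) hε).comp_hasFDerivAt x (hd x)).mul
    (((hg.fderiv_two_apply e).differentiable one_ne_zero x).hasFDerivAt)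
  rw [h1, h2.fderiv]
  simp only [add_apply, smul_apply, smul_eq_mul,
    Function.comp_apply]
  have : 0 ≤ fderiv ℝ g x e * (ε / √(g x ^ 2 + ε) ^ 3 * fderiv ℝ g x e) := by
    rw [mul_left_comm]
    exact mul_nonneg (by positivity) (mul_self_nonneg _)
  linarith

/-- Kato's inequality, tested against a nonnegative compactly supported function. -/
theorem integral_sign_mul_laplacian_mul_le {n : ℕ} {g ψ : EuclideanSpace ℝ (Fin n) → ℝ}
    (hg : ContDiff ℝ 2 g) (hψ : ContDiff ℝ 2 ψ) (hc : HasCompactSupport ψ) (hψ0 : ∀ x, 0 ≤ ψ x) :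
    ∫ x, Real.sign (g x) * laplacian g x * ψ x ≤ ∫ x, |g x| * laplacian ψ x := by
  have hpos (k : ℕ) : 0 < 1 / ((k : ℝ) + 1) := by positivity
  have hle1 (k : ℕ) : 1 / ((k : ℝ) + 1) ≤ 1 := by
    rw [div_le_one (by positivity)]; linarith [k.cast_nonneg (α := ℝ)]
  have hne (k : ℕ) (x) : g x ^ 2 + 1 / ((k : ℝ) + 1) ≠ 0 := by have := hpos k; positivity
  have hcont (k : ℕ) : Continuous fun x => g x / √(g x ^ 2 + 1 / ((k : ℝ) + 1)) := by
    have := hg.continuous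
    refine this.div (by fun_prop) fun x => ?_
    have := hpos k
    positivity
  have hL := hg.continuous_laplacian
  have hLψ := hψ.continuous_laplacian
  have hsqrt (k : ℕ) : ContDiff ℝ 2 fun x => √(g x ^ 2 + 1 / ((k : ℝ) + 1)) :=
    ((hg.pow 2).add contDiff_const).sqrt (hne k)
  refine le_of_tendsto_of_tendsto' (b := (atTop : Filter ℕ))
    (f := fun k : ℕ => ∫ x, g x / √(g x ^ 2 + 1 / ((k : ℝ) + 1)) * laplacian g x * ψ x)
    (g := fun k : ℕ => ∫ x, √(g x ^ 2 + 1 / ((k : ℝ) + 1)) * laplacian ψ x) ?_ ?_ fun k => ?_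
  · have hbound : Integrable fun x => |laplacian g x| * ψ x :=
      (hL.abs.mul hψ.continuous).integrable_of_hasCompactSupport hc.mul_left
    refine tendsto_integral_of_dominated_convergence _
      (fun k => (((hcont k).mul hL).mul hψ.continuous).aestronglyMeasurable)
      hbound (fun k => .of_forall fun x => ?_) (.of_forall fun x => ?_)
    · rw [Real.norm_eq_abs, abs_mul, abs_mul, abs_of_nonneg (hψ0 x)]
      exact mul_le_mul_of_nonneg_right (mul_le_of_le_one_left (abs_nonneg _)
        (abs_div_sqrt_sq_add_le_one _ (hpos k).le)) (hψ0 x)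
    · exact ((tendsto_div_sqrt_sq_add (g x)).mul_const _).mul_const _
  · have hbound : Integrable fun x => √(g x ^ 2 + 1) * |laplacian ψ x| := by
      have := hg.continuous
      have h : HasCompactSupport fun x => |laplacian ψ x| := hc.laplacian.comp_left abs_zero
      exact Continuous.integrable_of_hasCompactSupport (by fun_prop) h.mul_left
    refine tendsto_integral_of_dominated_convergence _
      (fun k => ((hsqrt k).continuous.mul hLψ).aestronglyMeasurable)
      hbound (fun k => .of_forall fun x => ?_) (.of_forall fun x => ?_)
    · rw [Real.norm_eq_abs, abs_mul, abs_of_nonneg (Real.sqrt_nonneg _)]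
      gcongr
      exact hle1 k
    · exact (tendsto_sqrt_sq_add (g x)).mul_const _
  · rw [integral_mul_laplacian_eq (hsqrt k) hψ hc]
    refine integral_mono
      ((((hcont k).mul hL).mul hψ.continuous).integrable_of_hasCompactSupport hc.mul_left)
      (((hsqrt k).continuous_laplacian.mul hψ.continuous).integrable_of_hasCompactSupport
        hc.mul_left) fun x => ?_
    exact mul_le_mul_of_nonneg_right
      (mul_laplacian_le_laplacian_sqrt_sq_add hg (hpos k) x) (hψ0 x)

theorem integral_abs_mul_sub_eq {X : Type*} [PseudoMetricSpace X] [T2Space X]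
    [SecondCountableTopology X] [MeasurableSpace X] [BorelSpace X] {μ : Measure X}
    [IsFiniteMeasureOnCompacts μ] [SFinite μ] {w d : X → ℝ → ℝ} {ψ : X → ℝ} {K : Set X}
    (hK : IsCompact K) (hψ : Continuous ψ) (hψK : ∀ x ∉ K, ψ x = 0) {a b : ℝ} (hab : a ≤ b)
    (hw : ContinuousOn (fun q : X × ℝ => w q.1 q.2) (Set.univ ×ˢ Set.Icc a b))
    (hd : ContinuousOn (fun q : X × ℝ => d q.1 q.2) (Set.univ ×ˢ Set.Icc a b))
    (hwd : ∀ x, ∀ τ ∈ Set.Icc a b, HasDerivAt (w x) (d x τ) τ) :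
    IntervalIntegrable (fun τ => ∫ x, Real.sign (w x τ) * d x τ * ψ x ∂μ) volume a b ∧
    (∫ x, |w x b| * ψ x ∂μ) - ∫ x, |w x a| * ψ x ∂μ =
      ∫ τ in a..b, ∫ x, Real.sign (w x τ) * d x τ * ψ x ∂μ := by
  have hmeas : MeasurableSet (K ×ˢ Set.Icc a b) := hK.measurableSet.prod measurableSet_Icc
  have hsub : K ×ˢ Set.Icc a b ⊆ Set.univ ×ˢ Set.Icc a b :=
    Set.prod_mono (Set.subset_univ _) subset_rfl
  have hF : IntegrableOn (fun q : X × ℝ => Real.sign (w q.1 q.2) * (d q.1 q.2 * ψ q.1))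
      (K ×ˢ Set.Icc a b) (μ.prod volume) := by
    have h1 : IntegrableOn (fun q : X × ℝ => d q.1 q.2 * ψ q.1)
        (K ×ˢ Set.Icc a b) (μ.prod volume) :=
      ContinuousOn.integrableOn_compact (hK.prod isCompact_Icc)
        ((hd.mono hsub).mul (by fun_prop))
    refine Integrable.bdd_mul (c := 1) h1 ?_ (.of_forall fun q => abs_real_sign_le_one _)
    exact (measurable_real_sign.comp_aemeasurable
      ((hw.mono hsub).aemeasurable hmeas)).aestronglyMeasurable
  have hF' : Integrable (Function.uncurry fun x τ => Real.sign (w x τ) * d x τ * ψ x)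
      ((μ.restrict K).prod (volume.restrict (Set.Ioc a b))) := by
    rw [Measure.prod_restrict]
    refine (hF.mono_set (Set.prod_mono subset_rfl Set.Ioc_subset_Icc_self)).congr
      (.of_forall fun q => ?_)
    simp only [Function.uncurry, mul_assoc]
  have hKint (f : X → ℝ) : ∫ x in K, f x * ψ x ∂μ = ∫ x, f x * ψ x ∂μ :=
    setIntegral_eq_integral_of_forall_compl_eq_zero fun x hx => by rw [hψK x hx, mul_zero]
  have hslice (τ : ℝ) (hτ : τ ∈ Set.Icc a b) : IntegrableOn (fun x => |w x τ| * ψ x) K μ := by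
    refine ContinuousOn.integrableOn_compact hK (ContinuousOn.mul ?_ hψ.continuousOn)
    exact (hw.comp (f := fun x => (x, τ)) (by fun_prop) fun x _ => ⟨trivial, hτ⟩).abs
  constructor
  · rw [intervalIntegrable_iff_integrableOn_Ioc_of_le hab]
    have h := hF'.integral_prod_right
    simp only [Function.uncurry, hKint] at h
    exact h
  · rw [intervalIntegral.integral_of_le hab]
    simp_rw [← hKint]
    rw [← integral_integral_swap hF', ← integral_sub (hslice b (Set.right_mem_Icc.2 hab))
      (hslice a (Set.left_mem_Icc.2 hab))]
    congr 1 with x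
    rw [integral_mul_const, ← sub_mul, ← intervalIntegral.integral_of_le hab,
      integral_sign_mul_deriv hab (hwd x)]
    exact hd.comp (f := fun τ => (x, τ)) (by fun_prop) fun τ hτ => ⟨trivial, hτ⟩

theorem ContDiffOn.continuousOn_deriv_snd {E : Type*} [NormedAddCommGroup E] [NormedSpace ℝ E]
    {w d : E → ℝ → ℝ} {S : Set (E × ℝ)} (hS : IsOpen S)
    (hw : ContDiffOn ℝ 1 (fun q : E × ℝ => w q.1 q.2) S)
    (hwd : ∀ x τ, (x, τ) ∈ S → HasDerivAt (w x) (d x τ) τ) :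
    ContinuousOn (fun q : E × ℝ => d q.1 q.2) S := by
  have h := (hw.continuousOn_fderiv_of_isOpen hS le_rfl).clm_apply
    (continuousOn_const (c := ((0 : E), (1 : ℝ))))
  refine h.congr fun q hq => ?_
  have h1 : HasFDerivAt (fun q : E × ℝ => w q.1 q.2) _ (q.1, q.2) :=
    ((hw.contDiffAt (hS.mem_nhds hq)).differentiableAt one_ne_zero).hasFDerivAt
  have h2 : HasDerivAt (fun τ : ℝ => (q.1, τ)) ((0 : E), (1 : ℝ)) q.2 :=
    (hasDerivAt_const _ _).prodMk (hasDerivAt_id _)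
  exact (hwd q.1 q.2 hq).unique (h1.comp_hasDerivAt q.2 h2)

theorem contDiff_rpow_slice {E : Type*} [NormedAddCommGroup E] [NormedSpace ℝ E]
    {u : E → ℝ → ℝ} (hu_pos : ∀ x, ∀ t > (0 : ℝ), 0 < u x t)
    (hu : ContDiffOn ℝ (⊤ : ℕ∞) (fun q : E × ℝ => u q.1 q.2) (Set.univ ×ˢ Set.Ioi 0))
    (m : ℝ) {t : ℝ} (ht : 0 < t) : ContDiff ℝ 2 fun x => u x t ^ m := by
  have h : ContDiff ℝ (⊤ : ℕ∞) fun x => u x t :=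
    hu.comp_contDiff (f := fun x => (x, t)) (by fun_prop) fun x => ⟨trivial, ht⟩
  exact (h.of_le (by norm_cast)).rpow_const_of_ne fun x => (hu_pos x t ht).ne'

theorem integral_abs_rpow_sub_mul_laplacian_le {n : ℕ} {m : ℝ} (hm : m ∈ Set.Ioo (0 : ℝ) 1)
    {f g ψ : EuclideanSpace ℝ (Fin n) → ℝ} (hf : Continuous f) (hg : Continuous g)
    (hf0 : ∀ x, 0 ≤ f x) (hg0 : ∀ x, 0 ≤ g x) (hψ : ContDiff ℝ 2 ψ) (hψ0 : ∀ x, 0 ≤ ψ x)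
    {K : Set (EuclideanSpace ℝ (Fin n))} (hK : IsCompact K) (hψK : ∀ x ∉ K, ψ x = 0)
    {B : ℝ} (hB : 0 ≤ B) (hΔψ : ∀ x, |laplacian ψ x| ≤ B * ψ x ^ m) :
    ∫ x, |f x ^ m - g x ^ m| * laplacian ψ x ≤
      B * (volume K).toReal ^ (1 - m) * (∫ x, |f x - g x| * ψ x) ^ m := by
  have hL := hψ.continuous_laplacian
  have hψc := hψ.continuous
  have hfm : Continuous fun x => f x ^ m := hf.rpow_const fun _ => Or.inr hm.1.le
  have hgm : Continuous fun x => g x ^ m := hg.rpow_const fun _ => Or.inr hm.1.le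
  have h0 (x) (hx : x ∉ K) : laplacian ψ x = 0 := by
    have := hΔψ x
    rw [hψK x hx, Real.zero_rpow hm.1.ne', mul_zero] at this
    exact abs_nonpos_iff.1 this
  have hI (x) : 0 ≤ |f x - g x| * ψ x := mul_nonneg (abs_nonneg _) (hψ0 x)
  have hIc : Continuous fun x => |f x - g x| * ψ x := by fun_prop
  rw [← setIntegral_eq_integral_of_forall_compl_eq_zero (s := K)
      fun x hx => by rw [h0 x hx, mul_zero],
    ← setIntegral_eq_integral_of_forall_compl_eq_zero (s := K)
      (f := fun x => |f x - g x| * ψ x) fun x hx => by rw [hψK x hx, mul_zero]]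
  calc ∫ x in K, |f x ^ m - g x ^ m| * laplacian ψ x
      ≤ ∫ x in K, B * (|f x - g x| * ψ x) ^ m := by
        refine integral_mono ?_ ?_ fun x => ?_
        · exact ContinuousOn.integrableOn_compact hK (by fun_prop)
        · exact ContinuousOn.integrableOn_compact hK
            ((hIc.rpow_const fun _ => Or.inr hm.1.le).const_mul B).continuousOn
        · calc |f x ^ m - g x ^ m| * laplacian ψ x
              ≤ |f x - g x| ^ m * (B * ψ x ^ m) :=
                mul_le_mul_of_nonneg (abs_rpow_sub_rpow_le hm.1.le hm.2.le (hf0 x) (hg0 x))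
                  ((le_abs_self _).trans (hΔψ x)) (abs_nonneg _)
                  (mul_nonneg hB (Real.rpow_nonneg (hψ0 x) m))
            _ = B * (|f x - g x| * ψ x) ^ m := by
                rw [Real.mul_rpow (abs_nonneg _) (hψ0 x)]; ring
    _ = B * ∫ x in K, (|f x - g x| * ψ x) ^ m := integral_const_mul _ _
    _ ≤ _ := by
        rw [mul_assoc]
        exact mul_le_mul_of_nonneg_left (setIntegral_rpow_le hK.measure_ne_top hm hI
          (hIc.continuousOn.integrableOn_compact hK)) hB

theorem stmt_11 (n : ℕ) (hn : 1 ≤ n) (m : ℝ) (hm : m ∈ Set.Ioo (0:ℝ) 1)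
    (u v : EuclideanSpace ℝ (Fin n) → ℝ → ℝ)
    (hu_pos : ∀ x, ∀ t > (0:ℝ), 0 < u x t)
    (hv_pos : ∀ x, ∀ t > (0:ℝ), 0 < v x t)
    (hu_smooth : ContDiffOn ℝ (⊤ : ℕ∞) (fun q : EuclideanSpace ℝ (Fin n) × ℝ => u q.1 q.2)
      (Set.univ ×ˢ Set.Ioi 0))
    (hv_smooth : ContDiffOn ℝ (⊤ : ℕ∞) (fun q : EuclideanSpace ℝ (Fin n) × ℝ => v q.1 q.2)
      (Set.univ ×ˢ Set.Ioi 0))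
    (hu_eq : ∀ x, ∀ t > (0:ℝ),
      HasDerivAt (fun τ => u x τ) (laplacian (fun y => u y t ^ m) x) t)
    (hv_eq : ∀ x, ∀ t > (0:ℝ),
      HasDerivAt (fun τ => v x τ) (laplacian (fun y => v y t ^ m) x) t)
    (ψ : EuclideanSpace ℝ (Fin n) → ℝ) (hψ : ContDiff ℝ 2 ψ)
    (hψ0 : ∀ x, 0 ≤ ψ x)
    (K : Set (EuclideanSpace ℝ (Fin n))) (hK : IsCompact K)
    (hsupp : Function.support ψ ⊆ K)
    (B : ℝ) (hB : 0 ≤ B)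
    (hΔψ : ∀ x, |laplacian ψ x| ≤ B * ψ x ^ m)
    (s t : ℝ) (hs : 0 < s) (hst : s ≤ t) :
    (∫ x, |u x t - v x t| * ψ x) ^ (1 - m) ≤
      (∫ x, |u x s - v x s| * ψ x) ^ (1 - m) +
        (1 - m) * 2 ^ (1 - m) * B * (volume K).toReal ^ (1 - m) * (t - s) := by
  set C : ℝ := B * (volume K).toReal ^ (1 - m) with hCdef
  have hC : 0 ≤ C := mul_nonneg hB (Real.rpow_nonneg ENNReal.toReal_nonneg _)
  have hψK : ∀ x ∉ K, ψ x = 0 := fun x hx => by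
    by_contra h
    exact hx (hsupp h)
  have hc : HasCompactSupport ψ := HasCompactSupport.intro hK hψK
  set w : EuclideanSpace ℝ (Fin n) → ℝ → ℝ := fun x τ => u x τ - v x τ with hw
  set d : EuclideanSpace ℝ (Fin n) → ℝ → ℝ := fun x τ =>
    laplacian (fun y => u y τ ^ m) x - laplacian (fun y => v y τ ^ m) x with hd
  have hwd : ∀ x, ∀ τ > (0 : ℝ), HasDerivAt (w x) (d x τ) τ := fun x τ hτ =>
    (hu_eq x τ hτ).sub (hv_eq x τ hτ)
  have hwsm : ContDiffOn ℝ 1 (fun q : EuclideanSpace ℝ (Fin n) × ℝ => w q.1 q.2)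
      (Set.univ ×ˢ Set.Ioi 0) :=
    (hu_smooth.sub hv_smooth).of_le (by exact_mod_cast le_top)
  have hdc := hwsm.continuousOn_deriv_snd (isOpen_univ.prod isOpen_Ioi)
    fun x τ h => hwd x τ h.2
  have hzc : ContinuousOn (fun τ => ∫ x, |w x τ| * ψ x) (Set.Ioi 0) := by
    refine continuousOn_integral_of_compact_support hK ?_ fun τ x _ hx => by
      rw [hψK x hx, mul_zero]
    have hψc := hψ.continuous
    refine ContinuousOn.mul (ContinuousOn.abs ?_) (by fun_prop)
    exact hwsm.continuousOn.comp (f := fun q : ℝ × EuclideanSpace ℝ (Fin n) => (q.2, q.1))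
      (by fun_prop) fun q hq => ⟨trivial, hq.1⟩
  have hmax (τ : ℝ) : 0 < max s τ := lt_max_of_lt_left hs
  set z : ℝ → ℝ := fun τ => ∫ x, |w x (max s τ)| * ψ x with hz
  have hzcont : Continuous z := hzc.comp_continuous (f := fun τ => max s τ) (by fun_prop) hmax
  have hz0 (τ : ℝ) : 0 ≤ z τ :=
    integral_nonneg fun x => mul_nonneg (abs_nonneg _) (hψ0 x)
  have slice (τ : ℝ) (hτ : 0 < τ) : ∫ x, Real.sign (w x τ) * d x τ * ψ x ≤
      C * (∫ x, |w x τ| * ψ x) ^ m := by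
    have hum := contDiff_rpow_slice hu_pos hu_smooth m hτ
    have hvm := contDiff_rpow_slice hv_pos hv_smooth m hτ
    have hu1 : Continuous fun x => u x τ := by
      simpa using (contDiff_rpow_slice hu_pos hu_smooth 1 hτ).continuous
    have hv1 : Continuous fun x => v x τ := by
      simpa using (contDiff_rpow_slice hv_pos hv_smooth 1 hτ).continuous
    refine le_trans ?_ (integral_abs_rpow_sub_mul_laplacian_le hm hu1 hv1
      (fun x => (hu_pos x τ hτ).le) (fun x => (hv_pos x τ hτ).le) hψ hψ0 hK hψK hB hΔψ)
    refine le_trans (le_of_eq ?_) (integral_sign_mul_laplacian_mul_le (hum.sub hvm) hψ hc hψ0)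
    refine integral_congr_ae (.of_forall fun x => ?_)
    simp only [hw, hd]
    rw [sign_rpow_sub_rpow hm.1 (hu_pos x τ hτ).le (hv_pos x τ hτ).le, laplacian_sub hum hvm]
  have key : ∀ b, s ≤ b → z b ≤ z s + C * ∫ τ in s..b, z τ ^ m := by
    intro b hb
    have hsub : (Set.univ : Set (EuclideanSpace ℝ (Fin n))) ×ˢ Set.Icc s b ⊆
        Set.univ ×ˢ Set.Ioi 0 :=
      Set.prod_mono subset_rfl fun τ hτ => hs.trans_le hτ.1
    obtain ⟨hint, heq⟩ := integral_abs_mul_sub_eq (μ := volume) hK hψ.continuous hψK hb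
      (hwsm.continuousOn.mono hsub) (hdc.mono hsub) fun x τ hτ => hwd x τ (hs.trans_le hτ.1)
    have hle : ∫ τ in s..b, ∫ x, Real.sign (w x τ) * d x τ * ψ x ≤
        ∫ τ in s..b, C * z τ ^ m := by
      refine intervalIntegral.integral_mono_on hb hint
        ((hzcont.rpow_const fun _ => Or.inr hm.1.le).const_mul C |>.intervalIntegrable _ _)
        fun τ hτ => ?_
      simp only [hz, max_eq_right hτ.1]
      exact slice τ (hs.trans_le hτ.1)
    rw [intervalIntegral.integral_const_mul] at hle
    have hzb : z b = ∫ x, |w x b| * ψ x := by simp only [hz, max_eq_right hb]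
    have hzs : z s = ∫ x, |w x s| * ψ x := by simp only [hz, max_self]
    rw [hzb, hzs]
    linarith
  have hfin := rpow_le_rpow_add_of_le_integral_rpow hm hC hst hzcont hz0 key
  simp only [hz, max_eq_right hst, max_self] at hfin
  refine hfin.trans (add_le_add_right ?_ _)
  have h2 : (1 : ℝ) ≤ 2 ^ (1 - m) := Real.one_le_rpow one_le_two (by linarith [hm.2])
  have h3 : 0 ≤ (1 - m) * C * (t - s) :=
    mul_nonneg (mul_nonneg (by linarith [hm.2]) hC) (sub_nonneg.2 hst)
  calc (1 - m) * C * (t - s) ≤ 2 ^ (1 - m) * ((1 - m) * C * (t - s)) :=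
        le_mul_of_one_le_left h3 h2
    _ = _ := by rw [hCdef]; ring
end
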